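/- arXiv:2105.09602 — 3 statements merged into one kernel-verified Lean document; each statement's English description precedes it below -/
import Mathlib

section
/- In a given instance of the super-stable matching problem, the same set of vertices is matched in all super-stable matchings: if M and N are super-stable matchings of G, then a vertex v is matched in M if and only if v is matched in N. -/
open scoped Classical

/-- An instance of the super-stable matching problem: a finite bipartite graph with
men `A`, women `B`, edge set `E`, and for each vertex a total preorder (preference
list with ties) on its neighbors. `prefA a b b'` means `b ⪰_a b'`. -/
structure SMInstance (A B : Type*) where
  E : Finset (A × B)
  prefA : A → B → B → Prop
  prefB : B → A → A → Prop
  prefA_refl : ∀ a b, (a, b) ∈ E → prefA a b b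
  prefA_trans : ∀ a b₁ b₂ b₃, prefA a b₁ b₂ → prefA a b₂ b₃ → prefA a b₁ b₃
  prefA_total : ∀ a b₁ b₂, (a, b₁) ∈ E → (a, b₂) ∈ E → prefA a b₁ b₂ ∨ prefA a b₂ b₁
  prefB_refl : ∀ b a, (a, b) ∈ E → prefB b a a
  prefB_trans : ∀ b a₁ a₂ a₃, prefB b a₁ a₂ → prefB b a₂ a₃ → prefB b a₁ a₃
  prefB_total : ∀ b a₁ a₂, (a₁, b) ∈ E → (a₂, b) ∈ E → prefB b a₁ a₂ ∨ prefB b a₂ a₁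

namespace SMInstance

variable {A B : Type*}

/-- A matching: a set of pairwise disjoint edges of the graph. -/
def IsMatching (I : SMInstance A B) (M : Finset (A × B)) : Prop :=
  M ⊆ I.E ∧
  (∀ p ∈ M, ∀ q ∈ M, p.1 = q.1 → p = q) ∧
  (∀ p ∈ M, ∀ q ∈ M, p.2 = q.2 → p = q)

/-- `(a,b)` is a blocking edge for `M`: it is an edge outside `M`, `a` is unmatched
or weakly prefers `b` to its partner, and `b` is unmatched or weakly prefers `a` to
its partner. -/
def Blocks (I : SMInstance A B) (M : Finset (A × B)) (a : A) (b : B) : Prop :=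
  (a, b) ∈ I.E ∧ (a, b) ∉ M ∧
  (∀ b', (a, b') ∈ M → I.prefA a b b') ∧
  (∀ a', (a', b) ∈ M → I.prefB b a a')

/-- A super-stable matching: a matching with no blocking edge. -/
def SuperStable (I : SMInstance A B) (M : Finset (A × B)) : Prop :=
  I.IsMatching M ∧ ∀ a b, ¬ I.Blocks M a b

/-- `M` dominates `N`: every man matched in `N` is matched in `M` to a partner he
weakly prefers. -/
def Dominates (I : SMInstance A B) (M N : Finset (A × B)) : Prop :=
  ∀ a b, (a, b) ∈ N → ∃ b', (a, b') ∈ M ∧ I.prefA a b' b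

/-- Strict preference `b ≻_a b'`. -/
def SPrefA (I : SMInstance A B) (a : A) (b b' : B) : Prop :=
  I.prefA a b b' ∧ ¬ I.prefA a b' b

/-- Strict preference `a ≻_b a'`. -/
def SPrefB (I : SMInstance A B) (b : B) (a a' : A) : Prop :=
  I.prefB b a a' ∧ ¬ I.prefB b a' a

end SMInstance

namespace SMInstance

/-- The men matched in both `M` and `N` who strictly prefer their partner in `N`. -/
noncomputable def menPreferring {A B : Type*} (I : SMInstance A B)
    (M N : Finset (A × B)) : Finset A :=
  ((M \ N).image Prod.fst).filter
    fun a => ∃ b b', (a, b) ∈ M ∧ (a, b') ∈ N ∧ ¬ I.prefA a b b'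

/-- The women matched in both `M` and `N` who strictly prefer their partner in `N`. -/
noncomputable def womenPreferring {A B : Type*} (I : SMInstance A B)
    (M N : Finset (A × B)) : Finset B :=
  ((M \ N).image Prod.snd).filter
    fun b => ∃ a a', (a, b) ∈ M ∧ (a', b) ∈ N ∧ ¬ I.prefB b a a'

variable {A B : Type*} {I : SMInstance A B} {M N : Finset (A × B)}

theorem IsMatching.right_unique (hM : I.IsMatching M) {a : A} {b b' : B}
    (h : (a, b) ∈ M) (h' : (a, b') ∈ M) : b = b' :=
  congrArg Prod.snd (hM.2.1 _ h _ h' rfl)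

theorem IsMatching.left_unique (hM : I.IsMatching M) {a a' : A} {b : B}
    (h : (a, b) ∈ M) (h' : (a', b) ∈ M) : a = a' :=
  congrArg Prod.fst (hM.2.2 _ h _ h' rfl)

theorem IsMatching.card_image_fst_sdiff (hM : I.IsMatching M) :
    ((M \ N).image Prod.fst).card = (M \ N).card :=
  Finset.card_image_of_injOn fun p hp q hq h =>
    hM.2.1 p (Finset.mem_sdiff.1 hp).1 q (Finset.mem_sdiff.1 hq).1 h

theorem IsMatching.card_image_snd_sdiff (hM : I.IsMatching M) :
    ((M \ N).image Prod.snd).card = (M \ N).card :=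
  Finset.card_image_of_injOn fun p hp q hq h =>
    hM.2.2 p (Finset.mem_sdiff.1 hp).1 q (Finset.mem_sdiff.1 hq).1 h

/-- Every edge of `M \ N` has an endpoint that strictly prefers `N`. -/
theorem card_sdiff_le (hM : I.IsMatching M) (hN : I.SuperStable N) :
    (M \ N).card ≤ (I.menPreferring M N).card + (I.womenPreferring M N).card := by
  have hsub : M \ N ⊆ (M \ N).filter (fun p => p.1 ∈ I.menPreferring M N) ∪
      (M \ N).filter (fun p => p.2 ∈ I.womenPreferring M N) := by
    rintro ⟨a, b⟩ hp
    obtain ⟨hpM, hpN⟩ := Finset.mem_sdiff.1 hp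
    rw [Finset.mem_union, Finset.mem_filter, Finset.mem_filter]
    by_cases hA : ∀ b', (a, b') ∈ N → I.prefA a b b'
    · by_cases hB : ∀ a', (a', b) ∈ N → I.prefB b a a'
      · exact absurd ⟨hM.1 hpM, hpN, hA, hB⟩ (hN.2 a b)
      · push Not at hB
        obtain ⟨a', ha', h⟩ := hB
        exact Or.inr ⟨hp, Finset.mem_filter.2
          ⟨Finset.mem_image_of_mem Prod.snd hp, a, a', hpM, ha', h⟩⟩
    · push Not at hA
      obtain ⟨b', hb', h⟩ := hA
      exact Or.inl ⟨hp, Finset.mem_filter.2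
        ⟨Finset.mem_image_of_mem Prod.fst hp, b, b', hpM, hb', h⟩⟩
  refine (Finset.card_le_card hsub).trans ((Finset.card_union_le _ _).trans
    (Nat.add_le_add ?_ ?_))
  · refine Finset.card_le_card_of_injOn Prod.fst
      (fun p hp => (Finset.mem_filter.1 hp).2) fun p hp q hq h => ?_
    exact hM.2.1 p (Finset.mem_sdiff.1 (Finset.mem_filter.1 hp).1).1
      q (Finset.mem_sdiff.1 (Finset.mem_filter.1 hq).1).1 h
  · refine Finset.card_le_card_of_injOn Prod.snd
      (fun p hp => (Finset.mem_filter.1 hp).2) fun p hp q hq h => ?_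
    exact hM.2.2 p (Finset.mem_sdiff.1 (Finset.mem_filter.1 hp).1).1
      q (Finset.mem_sdiff.1 (Finset.mem_filter.1 hq).1).1 h

theorem menPreferring_subset (hM : I.IsMatching M) (hN : I.IsMatching N) :
    I.menPreferring M N ⊆ (M \ N).image Prod.fst ∩ (N \ M).image Prod.fst := by
  intro a ha
  obtain ⟨haM, b, b', hb, hb', h⟩ := Finset.mem_filter.1 ha
  refine Finset.mem_inter.2 ⟨haM, Finset.mem_image.2
    ⟨(a, b'), Finset.mem_sdiff.2 ⟨hb', fun hc => h ?_⟩, rfl⟩⟩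
  obtain rfl := hM.right_unique hb hc
  exact I.prefA_refl a b (hN.1 hb')

theorem womenPreferring_subset (hM : I.IsMatching M) (hN : I.IsMatching N) :
    I.womenPreferring M N ⊆ (M \ N).image Prod.snd ∩ (N \ M).image Prod.snd := by
  intro b hb
  obtain ⟨hbM, a, a', ha, ha', h⟩ := Finset.mem_filter.1 hb
  refine Finset.mem_inter.2 ⟨hbM, Finset.mem_image.2
    ⟨(a', b), Finset.mem_sdiff.2 ⟨ha', fun hc => h ?_⟩, rfl⟩⟩
  obtain rfl := hM.left_unique ha hc
  exact I.prefB_refl b a (hN.1 ha')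

theorem disjoint_menPreferring (hM : I.IsMatching M) (hN : I.IsMatching N) :
    Disjoint (I.menPreferring M N) (I.menPreferring N M) := by
  refine Finset.disjoint_left.2 fun a h₁ h₂ => ?_
  obtain ⟨-, b, b', hb, hb', h⟩ := Finset.mem_filter.1 h₁
  obtain ⟨-, c', c, hc', hc, h'⟩ := Finset.mem_filter.1 h₂
  obtain rfl := hM.right_unique hb hc
  obtain rfl := hN.right_unique hb' hc'
  exact (I.prefA_total a b b' (hM.1 hb) (hN.1 hb')).elim h h'

theorem disjoint_womenPreferring (hM : I.IsMatching M) (hN : I.IsMatching N) :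
    Disjoint (I.womenPreferring M N) (I.womenPreferring N M) := by
  refine Finset.disjoint_left.2 fun b h₁ h₂ => ?_
  obtain ⟨-, a, a', ha, ha', h⟩ := Finset.mem_filter.1 h₁
  obtain ⟨-, c', c, hc', hc, h'⟩ := Finset.mem_filter.1 h₂
  obtain rfl := hM.left_unique ha hc
  obtain rfl := hN.left_unique ha' hc'
  exact (I.prefB_total b a a' (hM.1 ha) (hN.1 ha')).elim h h'

theorem card_menPreferring_add_le (hM : I.IsMatching M) (hN : I.IsMatching N) :
    (I.menPreferring M N).card + (I.menPreferring N M).card ≤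
      ((M \ N).image Prod.fst ∩ (N \ M).image Prod.fst).card := by
  rw [← Finset.card_union_of_disjoint (disjoint_menPreferring hM hN)]
  refine Finset.card_le_card (Finset.union_subset (menPreferring_subset hM hN) ?_)
  rw [Finset.inter_comm]
  exact menPreferring_subset hN hM

theorem card_womenPreferring_add_le (hM : I.IsMatching M) (hN : I.IsMatching N) :
    (I.womenPreferring M N).card + (I.womenPreferring N M).card ≤
      ((M \ N).image Prod.snd ∩ (N \ M).image Prod.snd).card := by
  rw [← Finset.card_union_of_disjoint (disjoint_womenPreferring hM hN)]
  refine Finset.card_le_card (Finset.union_subset (womenPreferring_subset hM hN) ?_)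
  rw [Finset.inter_comm]
  exact womenPreferring_subset hN hM

/-- The endpoints of `M \ N` are endpoints of `N \ M`. -/
theorem SuperStable.image_sdiff_subset (hM : I.SuperStable M) (hN : I.SuperStable N) :
    (M \ N).image Prod.fst ⊆ (N \ M).image Prod.fst ∧
      (M \ N).image Prod.snd ⊆ (N \ M).image Prod.snd := by
  have hMN := card_sdiff_le hM.1 hN
  have hNM := card_sdiff_le hN.1 hM
  have hmen := card_menPreferring_add_le hM.1 hN.1
  have hwomen := card_womenPreferring_add_le hM.1 hN.1
  have hMfst := hM.1.card_image_fst_sdiff (N := N)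
  have hMsnd := hM.1.card_image_snd_sdiff (N := N)
  have hNfst := hN.1.card_image_fst_sdiff (N := M)
  have hNsnd := hN.1.card_image_snd_sdiff (N := M)
  have hfst_left := Finset.card_le_card (Finset.inter_subset_left
    (s₁ := (M \ N).image Prod.fst) (s₂ := (N \ M).image Prod.fst))
  have hfst_right := Finset.card_le_card (Finset.inter_subset_right
    (s₁ := (M \ N).image Prod.fst) (s₂ := (N \ M).image Prod.fst))
  have hsnd_left := Finset.card_le_card (Finset.inter_subset_left
    (s₁ := (M \ N).image Prod.snd) (s₂ := (N \ M).image Prod.snd))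
  have hsnd_right := Finset.card_le_card (Finset.inter_subset_right
    (s₁ := (M \ N).image Prod.snd) (s₂ := (N \ M).image Prod.snd))
  exact ⟨Finset.inter_eq_left.1
      (Finset.eq_of_subset_of_card_le Finset.inter_subset_left (by omega)),
    Finset.inter_eq_left.1
      (Finset.eq_of_subset_of_card_le Finset.inter_subset_left (by omega))⟩

theorem SuperStable.man_matched (hM : I.SuperStable M) (hN : I.SuperStable N) {a : A}
    (h : ∃ b, (a, b) ∈ M) : ∃ b, (a, b) ∈ N := by
  obtain ⟨b, hb⟩ := h
  by_cases hbN : (a, b) ∈ N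
  · exact ⟨b, hbN⟩
  · obtain ⟨⟨_, b'⟩, hp, rfl⟩ := Finset.mem_image.1 ((hM.image_sdiff_subset hN).1
      (Finset.mem_image_of_mem Prod.fst (Finset.mem_sdiff.2 ⟨hb, hbN⟩)))
    exact ⟨b', (Finset.mem_sdiff.1 hp).1⟩

theorem SuperStable.woman_matched (hM : I.SuperStable M) (hN : I.SuperStable N) {b : B}
    (h : ∃ a, (a, b) ∈ M) : ∃ a, (a, b) ∈ N := by
  obtain ⟨a, ha⟩ := h
  by_cases haN : (a, b) ∈ N
  · exact ⟨a, haN⟩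
  · obtain ⟨⟨a', _⟩, hp, rfl⟩ := Finset.mem_image.1 ((hM.image_sdiff_subset hN).2
      (Finset.mem_image_of_mem Prod.snd (Finset.mem_sdiff.2 ⟨ha, haN⟩)))
    exact ⟨a', (Finset.mem_sdiff.1 hp).1⟩

end SMInstance

/-- In a given instance of the super-stable matching problem, the same set of
vertices is matched in all super-stable matchings. -/
theorem same_vertices_matched {A B : Type*} (I : SMInstance A B)
    (M N : Finset (A × B)) (hM : I.SuperStable M) (hN : I.SuperStable N) :
    (∀ a : A, (∃ b, (a, b) ∈ M) ↔ (∃ b, (a, b) ∈ N)) ∧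
    (∀ b : B, (∃ a, (a, b) ∈ M) ↔ (∃ a, (a, b) ∈ N)) := by
  exact ⟨fun _ => ⟨hM.man_matched hN, hN.man_matched hM⟩,
    fun _ => ⟨hM.woman_matched hN, hN.woman_matched hM⟩⟩
end

section
/- Let x ∈ ℝ^E be a feasible solution of the super-stable matching linear system (a)–(c). Then for every vertex v that is covered by the support of x (i.e., x_{u,v} > 0 for some neighbor u), one has ∑_{u ∈ N(v)} x_{u,v} = 1, and the set of maximal elements of {i ∈ N(v) : x_{v,i} > 0} with respect to ⪰_v contains exactly one element. -/
open scoped Classical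

namespace SMInstance

variable {A B : Type*}

/-- The incidence vector `χ^M` of a set of edges `M`. -/
noncomputable def chi (M : Finset (A × B)) : A × B → ℝ :=
  fun p => if p ∈ M then 1 else 0

/-- `∑_{i ∈ N(a)} x_{a,i}`, the sum of `x` over the edges incident to the man `a`. -/
noncomputable def rowSum (I : SMInstance A B) (x : A × B → ℝ) (a : A) : ℝ :=
  ∑ p ∈ I.E.filter (fun p => p.1 = a), x p

/-- `∑_{j ∈ N(b)} x_{j,b}`, the sum of `x` over the edges incident to the woman `b`. -/
noncomputable def colSum (I : SMInstance A B) (x : A × B → ℝ) (b : B) : ℝ :=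
  ∑ p ∈ I.E.filter (fun p => p.2 = b), x p

/-- Constraint (b) of the super-stable matching linear system at edge `p = (u,v)`:
`∑_{i ≻_u v} x_{u,i} + ∑_{j ≻_v u} x_{j,v} + x_{u,v} ≥ 1`. -/
def StabIneq (I : SMInstance A B) (x : A × B → ℝ) (p : A × B) : Prop :=
  (∑ q ∈ I.E.filter (fun q => q.1 = p.1 ∧ I.SPrefA p.1 q.2 p.2), x q) +
  (∑ q ∈ I.E.filter (fun q => q.2 = p.2 ∧ I.SPrefB p.2 q.1 p.1), x q) +
  x p ≥ 1

/-- `x ∈ ℝ^E` is a feasible solution of the super-stable matching linear system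
(a)–(c). -/
def Feasible (I : SMInstance A B) (x : A × B → ℝ) : Prop :=
  (∀ p, p ∉ I.E → x p = 0) ∧
  (∀ a : A, I.rowSum x a ≤ 1) ∧
  (∀ b : B, I.colSum x b ≤ 1) ∧
  (∀ p ∈ I.E, I.StabIneq x p) ∧
  (∀ p, 0 ≤ x p)

end SMInstance

namespace SMInstance

variable {A B : Type*}

/-- The instance obtained by exchanging the roles of the two color classes. -/
def swap (I : SMInstance A B) : SMInstance B A where
  E := I.E.map (Equiv.prodComm A B).toEmbedding
  prefA := I.prefB
  prefB := I.prefA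
  prefA_refl b a h := I.prefB_refl b a (by simpa using h)
  prefA_trans := I.prefB_trans
  prefA_total b a₁ a₂ h₁ h₂ := I.prefB_total b a₁ a₂ (by simpa using h₁) (by simpa using h₂)
  prefB_refl a b h := I.prefA_refl a b (by simpa using h)
  prefB_trans := I.prefA_trans
  prefB_total a b₁ b₂ h₁ h₂ := I.prefA_total a b₁ b₂ (by simpa using h₁) (by simpa using h₂)

theorem mem_swap_E (I : SMInstance A B) (p : B × A) : p ∈ I.swap.E ↔ p.swap ∈ I.E := by
  obtain ⟨b, a⟩ := p
  simp [swap]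

theorem sum_swap_E_filter (I : SMInstance A B) (x : A × B → ℝ) (P : B × A → Prop)
    [DecidablePred P] [DecidablePred fun p : A × B => P p.swap] :
    ∑ p ∈ I.swap.E.filter P, x p.swap = ∑ p ∈ I.E.filter (fun p => P p.swap), x p :=
  Finset.sum_nbij' Prod.swap Prod.swap (by simp [mem_swap_E]) (by simp [mem_swap_E])
    (by simp) (by simp) (by simp)

theorem rowSum_swap (I : SMInstance A B) (x : A × B → ℝ) (b : B) :
    I.swap.rowSum (fun p => x p.swap) b = I.colSum x b :=
  I.sum_swap_E_filter x _

theorem colSum_swap (I : SMInstance A B) (x : A × B → ℝ) (a : A) :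
    I.swap.colSum (fun p => x p.swap) a = I.rowSum x a :=
  I.sum_swap_E_filter x _

theorem Feasible.swap {I : SMInstance A B} {x : A × B → ℝ} (hx : I.Feasible x) :
    I.swap.Feasible (fun p => x p.swap) := by
  obtain ⟨h0, hr, hc, hs, hn⟩ := hx
  refine ⟨fun p hp => h0 _ (by rwa [mem_swap_E] at hp), fun b => ?_, fun a => ?_,
    fun p hp => ?_, fun p => hn _⟩
  · rw [rowSum_swap]
    exact hc b
  · rw [colSum_swap]
    exact hr a
  · have h := hs p.swap ((I.mem_swap_E p).1 hp)
    unfold StabIneq at h ⊢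
    rw [add_comm (Finset.sum _ _)] at h
    convert h using 3 <;> exact I.sum_swap_E_filter x _

/-- `b` is a maximal element, with respect to the preferences of `a`, of the partners of `a`
in the support of `x`. -/
def IsTop (I : SMInstance A B) (x : A × B → ℝ) (a : A) (b : B) : Prop :=
  (a, b) ∈ I.E ∧ 0 < x (a, b) ∧ ∀ i, (a, i) ∈ I.E → 0 < x (a, i) → ¬ I.SPrefA a i b

theorem exists_isTop (I : SMInstance A B) (x : A × B → ℝ) {a : A}
    (h : ∃ b, (a, b) ∈ I.E ∧ 0 < x (a, b)) : ∃ b, I.IsTop x a b := by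
  have : IsStrictOrder B (I.SPrefA a) :=
    { irrefl := fun b hb => hb.2 hb.1
      trans := fun b c d hbc hcd => ⟨I.prefA_trans a b c d hbc.1 hcd.1,
        fun hdb => hcd.2 (I.prefA_trans a d b c hdb hbc.1)⟩ }
  have hfin : {b | (a, b) ∈ I.E ∧ 0 < x (a, b)}.Finite :=
    (I.E.finite_toSet.preimage (Prod.mk_right_injective a).injOn).subset fun b hb => hb.1
  obtain ⟨⟨b, hb⟩, -, hmin⟩ :=
    (hfin.wellFoundedOn (r := I.SPrefA a)).has_min Set.univ ⟨⟨h.choose, h.choose_spec⟩, trivial⟩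
  exact ⟨b, hb.1, hb.2, fun i hi hxi => hmin ⟨i, hi, hxi⟩ trivial⟩

theorem IsTop.le_sum {I : SMInstance A B} {x : A × B → ℝ} (hx : I.Feasible x) {a : A} {b : B}
    (h : I.IsTop x a b) :
    1 ≤ ∑ q ∈ insert (a, b) (I.E.filter (fun q => q.2 = b ∧ I.SPrefB b q.1 a)), x q := by
  obtain ⟨-, -, -, hs, hn⟩ := hx
  have hstab := hs _ h.1
  unfold StabIneq at hstab
  have hzero : ∑ q ∈ I.E.filter (fun q => q.1 = a ∧ I.SPrefA a q.2 b), x q = 0 := by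
    refine Finset.sum_eq_zero fun q hq => ?_
    obtain ⟨hqE, rfl, hq⟩ := Finset.mem_filter.1 hq
    exact ((hn q).eq_or_lt.resolve_right fun hpos => h.2.2 q.2 hqE hpos hq).symm
  rw [Finset.sum_insert fun hmem => (Finset.mem_filter.1 hmem).2.2.2
    (Finset.mem_filter.1 hmem).2.2.1]
  dsimp only at hstab
  linarith

theorem insert_filter_subset (I : SMInstance A B) {a : A} {b : B} (h : (a, b) ∈ I.E) :
    insert (a, b) (I.E.filter (fun q => q.2 = b ∧ I.SPrefB b q.1 a)) ⊆
      I.E.filter (fun q => q.2 = b) := by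
  refine Finset.insert_subset (Finset.mem_filter.2 ⟨h, rfl⟩) fun q hq => ?_
  rw [Finset.mem_filter] at hq ⊢
  exact ⟨hq.1, hq.2.1⟩

theorem IsTop.colSum_eq_one {I : SMInstance A B} {x : A × B → ℝ} (hx : I.Feasible x) {a : A}
    {b : B} (h : I.IsTop x a b) : I.colSum x b = 1 :=
  le_antisymm (hx.2.2.1 b) <| (h.le_sum hx).trans <|
    Finset.sum_le_sum_of_subset_of_nonneg (I.insert_filter_subset h.1)
      fun p _ _ => hx.2.2.2.2 p

/-- If `b` is a top choice of `a`, then `a` is the strictly worst partner of `b` in the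
support. -/
theorem IsTop.sPrefB {I : SMInstance A B} {x : A × B → ℝ} (hx : I.Feasible x) {a a' : A}
    {b : B} (h : I.IsTop x a b) (hE : (a', b) ∈ I.E) (hpos : 0 < x (a', b)) (hne : a' ≠ a) :
    I.SPrefB b a' a := by
  by_contra hcon
  have hlt := Finset.sum_lt_sum_of_subset (f := x) (I.insert_filter_subset h.1)
    (i := (a', b)) (by simp [hE]) (by simp [hne, hcon]) hpos fun p _ _ => hx.2.2.2.2 p
  exact absurd ((h.le_sum hx).trans_lt hlt) (not_lt.2 (hx.2.2.1 b))

theorem IsTop.left_unique {I : SMInstance A B} {x : A × B → ℝ} (hx : I.Feasible x) {a a' : A}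
    {b : B} (h : I.IsTop x a b) (h' : I.IsTop x a' b) : a' = a := by
  by_contra hne
  exact (h.sPrefB hx h'.1 h'.2.1 hne).2 (h'.sPrefB hx h.1 h.2.1 (Ne.symm hne)).1

/-- The men covered by the support of `x`. -/
noncomputable def coveredA (I : SMInstance A B) (x : A × B → ℝ) : Finset A :=
  (I.E.filter (fun p => 0 < x p)).image Prod.fst

/-- The women covered by the support of `x`. -/
noncomputable def coveredB (I : SMInstance A B) (x : A × B → ℝ) : Finset B :=
  (I.E.filter (fun p => 0 < x p)).image Prod.snd

theorem mem_coveredA {I : SMInstance A B} {x : A × B → ℝ} {a : A} :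
    a ∈ I.coveredA x ↔ ∃ b, (a, b) ∈ I.E ∧ 0 < x (a, b) := by
  simp [coveredA]

theorem mem_coveredB {I : SMInstance A B} {x : A × B → ℝ} {b : B} :
    b ∈ I.coveredB x ↔ ∃ a, (a, b) ∈ I.E ∧ 0 < x (a, b) := by
  simp [coveredB]

theorem coveredA_swap (I : SMInstance A B) (x : A × B → ℝ) :
    I.swap.coveredA (fun p => x p.swap) = I.coveredB x := by
  ext b
  simp [mem_coveredA, mem_coveredB, mem_swap_E]

theorem coveredB_swap (I : SMInstance A B) (x : A × B → ℝ) :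
    I.swap.coveredB (fun p => x p.swap) = I.coveredA x := by
  ext a
  simp [mem_coveredA, mem_coveredB, mem_swap_E]

theorem exists_top_choice (I : SMInstance A B) (x : A × B → ℝ) :
    ∃ f : ∀ a ∈ I.coveredA x, B, ∀ a ha, I.IsTop x a (f a ha) :=
  ⟨fun _ ha => (I.exists_isTop x (mem_coveredA.1 ha)).choose,
    fun _ ha => (I.exists_isTop x (mem_coveredA.1 ha)).choose_spec⟩

theorem Feasible.card_coveredA_le {I : SMInstance A B} {x : A × B → ℝ} (hx : I.Feasible x) :
    (I.coveredA x).card ≤ (I.coveredB x).card := by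
  obtain ⟨f, hf⟩ := I.exists_top_choice x
  rw [← Finset.card_attach]
  refine Finset.card_le_card_of_injOn (fun a => f a.1 a.2)
    (fun a _ => mem_coveredB.2 ⟨a, (hf a.1 a.2).1, (hf a.1 a.2).2.1⟩) fun a _ a' _ h => ?_
  have h' := hf a'.1 a'.2
  rw [← show f a.1 a.2 = f a'.1 a'.2 from h] at h'
  exact Subtype.ext (h'.left_unique hx (hf a.1 a.2))

theorem Feasible.card_coveredB_le {I : SMInstance A B} {x : A × B → ℝ} (hx : I.Feasible x) :
    (I.coveredB x).card ≤ (I.coveredA x).card := by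
  have h := hx.swap.card_coveredA_le
  rwa [coveredA_swap, coveredB_swap] at h

theorem Feasible.surj_top_choice {I : SMInstance A B} {x : A × B → ℝ} (hx : I.Feasible x)
    {f : ∀ a ∈ I.coveredA x, B} (hf : ∀ a ha, I.IsTop x a (f a ha)) :
    ∀ b ∈ I.coveredB x, ∃ a ha, f a ha = b := by
  intro b hb
  obtain ⟨a, ha, h⟩ := Finset.surj_on_of_inj_on_of_card_le f
    (fun a ha => mem_coveredB.2 ⟨a, (hf a ha).1, (hf a ha).2.1⟩)
    (fun a a' ha ha' h => (h ▸ hf a' ha' : I.IsTop x a' (f a ha)).left_unique hx (hf a ha))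
    hx.card_coveredB_le b hb
  exact ⟨a, ha, h.symm⟩

theorem Feasible.existsUnique_isTop {I : SMInstance A B} {x : A × B → ℝ} (hx : I.Feasible x)
    {a : A} (ha : a ∈ I.coveredA x) : ∃! b, I.IsTop x a b := by
  obtain ⟨f, hf⟩ := I.exists_top_choice x
  refine ⟨f a ha, hf a ha, fun b hb => ?_⟩
  obtain ⟨a', ha', rfl⟩ := hx.surj_top_choice hf b (mem_coveredB.2 ⟨a, hb.1, hb.2.1⟩)
  obtain rfl := hb.left_unique hx (hf a' ha')
  rfl

theorem Feasible.colSum_eq_one {I : SMInstance A B} {x : A × B → ℝ} (hx : I.Feasible x)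
    {b : B} (hb : b ∈ I.coveredB x) : I.colSum x b = 1 := by
  obtain ⟨f, hf⟩ := I.exists_top_choice x
  obtain ⟨a, ha, rfl⟩ := hx.surj_top_choice hf b hb
  exact (hf a ha).colSum_eq_one hx

end SMInstance

/-- For a feasible solution `x` of the super-stable matching linear system and every
vertex `v` (of either color class) covered by the support of `x`, the sum of `x` over
the edges incident to `v` equals `1`, and the set of maximal elements (w.r.t. `⪰_v`)
of the support `{i ∈ N(v) : x_{v,i} > 0}` contains exactly one element. -/
theorem feasible_covered_vertex {A B : Type*} (I : SMInstance A B)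
    (x : A × B → ℝ) (hx : I.Feasible x) :
    (∀ a : A, (∃ b, (a, b) ∈ I.E ∧ 0 < x (a, b)) →
      I.rowSum x a = 1 ∧
      ∃! b, (a, b) ∈ I.E ∧ 0 < x (a, b) ∧
        ∀ i, (a, i) ∈ I.E → 0 < x (a, i) → ¬ I.SPrefA a i b) ∧
    (∀ b : B, (∃ a, (a, b) ∈ I.E ∧ 0 < x (a, b)) →
      I.colSum x b = 1 ∧
      ∃! a, (a, b) ∈ I.E ∧ 0 < x (a, b) ∧
        ∀ j, (j, b) ∈ I.E → 0 < x (j, b) → ¬ I.SPrefB b j a) := by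
  refine ⟨fun a h => ?_, fun b h => ?_⟩
  · have ha := SMInstance.mem_coveredA.2 h
    refine ⟨?_, hx.existsUnique_isTop ha⟩
    rw [← I.colSum_swap]
    exact hx.swap.colSum_eq_one (by rwa [I.coveredB_swap])
  · have hb := SMInstance.mem_coveredB.2 h
    refine ⟨hx.colSum_eq_one hb, ?_⟩
    have huniq := hx.swap.existsUnique_isTop (a := b) (by rwa [I.coveredA_swap])
    simp only [SMInstance.IsTop, SMInstance.mem_swap_E, Prod.swap_prod_mk] at huniq
    exact huniq
end

section
/- Any two feasible solutions x and y of the super-stable matching linear system (a)–(c) have the same coordinate sum: ∑_{(u,v) ∈ E} x_{u,v} = ∑_{(u,v) ∈ E} y_{u,v}. In particular, all super-stable matchings of G have the same cardinality. -/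
open scoped Classical

namespace SMInstance

variable {A B : Type*}

theorem SuperStable.feasible_chi {I : SMInstance A B} {M : Finset (A × B)}
    (hM : I.SuperStable M) : I.Feasible (chi M) := by
  obtain ⟨⟨hsub, hA, hB⟩, hblock⟩ := hM
  have hnn : ∀ p, 0 ≤ chi M p := fun p => by unfold chi; split_ifs <;> norm_num
  have one_le : ∀ (s : Finset (A × B)) (q), q ∈ s → q ∈ M → 1 ≤ ∑ r ∈ s, chi M r := by
    intro s q hq hqM
    have h := Finset.single_le_sum (f := chi M) (fun r _ => hnn r) hq
    simpa [chi, hqM] using h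
  refine ⟨fun p hp => if_neg fun h => hp (hsub h), fun a => ?_, fun b => ?_, ?_, hnn⟩
  · unfold rowSum chi
    rw [Finset.sum_boole]
    norm_cast
    refine Finset.card_le_one.2 fun p hp q hq => ?_
    simp only [Finset.mem_filter] at hp hq
    exact hA p hp.2 q hq.2 (hp.1.2.trans hq.1.2.symm)
  · unfold colSum chi
    rw [Finset.sum_boole]
    norm_cast
    refine Finset.card_le_one.2 fun p hp q hq => ?_
    simp only [Finset.mem_filter] at hp hq
    exact hB p hp.2 q hq.2 (hp.1.2.trans hq.1.2.symm)
  · rintro ⟨a, b⟩ hp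
    unfold StabIneq
    have h₁ : 0 ≤ ∑ q ∈ I.E.filter (fun q => q.1 = a ∧ I.SPrefA a q.2 b), chi M q :=
      Finset.sum_nonneg fun q _ => hnn q
    have h₂ : 0 ≤ ∑ q ∈ I.E.filter (fun q => q.2 = b ∧ I.SPrefB b q.1 a), chi M q :=
      Finset.sum_nonneg fun q _ => hnn q
    have h₃ := hnn (a, b)
    dsimp only
    by_cases hpM : (a, b) ∈ M
    · have : chi M (a, b) = 1 := if_pos hpM
      linarith
    by_cases ha : ∀ b', (a, b') ∈ M → I.prefA a b b'
    · have hb : ¬ ∀ a', (a', b) ∈ M → I.prefB b a a' := fun hb =>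
        hblock a b ⟨hp, hpM, ha, hb⟩
      push Not at hb
      obtain ⟨a', ha'M, hlt⟩ := hb
      have := one_le (I.E.filter (fun q => q.2 = b ∧ I.SPrefB b q.1 a)) (a', b)
        (Finset.mem_filter.2 ⟨hsub ha'M, rfl,
          (I.prefB_total b a' a (hsub ha'M) hp).resolve_right hlt, hlt⟩) ha'M
      linarith
    · push Not at ha
      obtain ⟨b', hb'M, hlt⟩ := ha
      have := one_le (I.E.filter (fun q => q.1 = a ∧ I.SPrefA a q.2 b)) (a, b')
        (Finset.mem_filter.2 ⟨hsub hb'M, rfl,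
          (I.prefA_total a b' b (hsub hb'M) hp).resolve_right hlt, hlt⟩) hb'M
      linarith

theorem SuperStable.sum_chi {I : SMInstance A B} {M : Finset (A × B)}
    (hM : I.SuperStable M) : ∑ p ∈ I.E, chi M p = M.card := by
  unfold chi
  rw [Finset.sum_boole, Finset.filter_mem_eq_inter, Finset.inter_eq_right.2 hM.1.1]

/-- The coefficient of `x q` in the stability constraint at the edge `p`. -/
noncomputable def stabCoeff (I : SMInstance A B) (p q : A × B) : ℝ :=
  (if q.1 = p.1 ∧ I.SPrefA p.1 q.2 p.2 then 1 else 0) +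
    (if q.2 = p.2 ∧ I.SPrefB p.2 q.1 p.1 then 1 else 0) + if q = p then 1 else 0

theorem StabIneq.one_le_sum {I : SMInstance A B} {x : A × B → ℝ} {p : A × B}
    (hp : p ∈ I.E) (h : I.StabIneq x p) : 1 ≤ ∑ q ∈ I.E, I.stabCoeff p q * x q := by
  unfold StabIneq at h
  simpa [stabCoeff, add_mul, Finset.sum_add_distrib, Finset.sum_filter, hp] using h

theorem stabCoeff_add_swap_le (I : SMInstance A B) (p q : A × B) :
    I.stabCoeff p q + I.stabCoeff q p ≤
      (if q.1 = p.1 then 1 else 0) + if q.2 = p.2 then 1 else 0 := by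
  obtain ⟨a, b⟩ := p
  obtain ⟨c, d⟩ := q
  have hA : ((if c = a ∧ I.SPrefA a d b then 1 else 0) + (if a = c ∧ I.SPrefA c b d then 1 else 0)
      + if c = a ∧ d = b then 1 else 0 : ℝ) ≤ if c = a then 1 else 0 := by
    by_cases h : c = a
    · subst h
      by_cases h' : d = b
      · subst h'; simp [SPrefA]
      · by_cases h₁ : I.prefA c d b <;> by_cases h₂ : I.prefA c b d <;> simp [SPrefA, h₁, h₂, h']
    · simp [h, Ne.symm h]
  have hB : ((if d = b ∧ I.SPrefB b c a then 1 else 0) + (if b = d ∧ I.SPrefB d a c then 1 else 0)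
      + if c = a ∧ d = b then 1 else 0 : ℝ) ≤ if d = b then 1 else 0 := by
    by_cases h : d = b
    · subst h
      by_cases h' : c = a
      · subst h'; simp [SPrefB]
      · by_cases h₁ : I.prefB d c a <;> by_cases h₂ : I.prefB d a c <;> simp [SPrefB, h₁, h₂, h']
    · simp [h, Ne.symm h]
  have hsymm : (a = c ∧ b = d) ↔ (c = a ∧ d = b) := by simp only [eq_comm]
  simp only [stabCoeff, Prod.mk.injEq, hsymm]
  linarith

theorem Feasible.sum_le_sum_stabCoeff {I : SMInstance A B} {x y : A × B → ℝ}
    (hx : I.Feasible x) (hy : I.Feasible y) :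
    ∑ p ∈ I.E, x p ≤ ∑ p ∈ I.E, ∑ q ∈ I.E, x p * y q * I.stabCoeff p q := by
  refine Finset.sum_le_sum fun p hp => ?_
  have h := mul_le_mul_of_nonneg_left ((hy.2.2.2.1 p hp).one_le_sum hp) (hx.2.2.2.2 p)
  rw [mul_one, Finset.mul_sum] at h
  exact h.trans_eq (Finset.sum_congr rfl fun q _ => by ring)

theorem Feasible.sum_incident_le {I : SMInstance A B} {x y : A × B → ℝ}
    (hx : I.Feasible x) (hy : I.Feasible y) :
    ∑ p ∈ I.E, ∑ q ∈ I.E,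
      x p * y q * ((if q.1 = p.1 then 1 else 0) + if q.2 = p.2 then 1 else 0) ≤
        2 * ∑ p ∈ I.E, x p := by
  rw [Finset.mul_sum]
  refine Finset.sum_le_sum fun p _ => ?_
  have hrow := hy.2.1 p.1
  have hcol := hy.2.2.1 p.2
  calc _ = x p * (I.rowSum y p.1 + I.colSum y p.2) := by
        simp only [rowSum, colSum, Finset.sum_filter, ← Finset.sum_add_distrib, Finset.mul_sum]
        refine Finset.sum_congr rfl fun q _ => ?_
        split_ifs <;> ring
    _ ≤ x p * 2 := mul_le_mul_of_nonneg_left (by linarith) (hx.2.2.2.2 p)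
    _ = 2 * x p := mul_comm _ _

theorem Feasible.sum_le_sum {I : SMInstance A B} {x y : A × B → ℝ}
    (hx : I.Feasible x) (hy : I.Feasible y) : ∑ p ∈ I.E, y p ≤ ∑ p ∈ I.E, x p := by
  have hxy := hx.sum_le_sum_stabCoeff hy
  have hyx := hy.sum_le_sum_stabCoeff hx
  rw [Finset.sum_comm] at hyx
  have hle : ∑ p ∈ I.E, ∑ q ∈ I.E, x p * y q * I.stabCoeff p q +
      ∑ p ∈ I.E, ∑ q ∈ I.E, y q * x p * I.stabCoeff q p ≤ ∑ p ∈ I.E, ∑ q ∈ I.E,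
        x p * y q * ((if q.1 = p.1 then 1 else 0) + if q.2 = p.2 then 1 else 0) := by
    simp only [← Finset.sum_add_distrib]
    refine Finset.sum_le_sum fun p _ => Finset.sum_le_sum fun q _ => ?_
    have h := mul_le_mul_of_nonneg_left (I.stabCoeff_add_swap_le p q)
      (mul_nonneg (hx.2.2.2.2 p) (hy.2.2.2.2 q))
    linarith
  linarith [hx.sum_incident_le hy]

end SMInstance

/-- Any two feasible solutions of the super-stable matching linear system have the
same coordinate sum; in particular, all super-stable matchings of `G` have the same
cardinality. -/
theorem feasible_same_sum {A B : Type*} (I : SMInstance A B) :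
    (∀ x y : A × B → ℝ, I.Feasible x → I.Feasible y →
      (∑ p ∈ I.E, x p) = ∑ p ∈ I.E, y p) ∧
    (∀ M N : Finset (A × B), I.SuperStable M → I.SuperStable N → M.card = N.card) := by
  have hsum : ∀ x y : A × B → ℝ, I.Feasible x → I.Feasible y →
      (∑ p ∈ I.E, x p) = ∑ p ∈ I.E, y p := fun x y hx hy =>
    le_antisymm (hy.sum_le_sum hx) (hx.sum_le_sum hy)
  refine ⟨hsum, fun M N hM hN => ?_⟩
  have h := hsum _ _ hM.feasible_chi hN.feasible_chi
  rw [hM.sum_chi, hN.sum_chi] at h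
  exact_mod_cast h
end
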